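/- arXiv:1401.5345 — 2 statements merged into one kernel-verified Lean document; each statement's English description precedes it below -/
import Mathlib

section
/- For all natural numbers n, the Fishburn number ξ(5n+3) is divisible by 5, where the Fishburn numbers are defined by the formal power series identity ∑_{n≥0} ξ(n) q^n = ∑_{n≥0} (1-q; 1-q)_n. -/
open Polynomial Finset

/-- The Fishburn numbers: ξ(n) is the coefficient of q^n in
∑_{j=0}^{n} ∏_{i=1}^{j} (1 - (1-q)^i). -/
noncomputable def fishburn (n : ℕ) : ℤ :=
  (∑ j ∈ Finset.range (n + 1), ∏ i ∈ Finset.range j, (1 - (1 - X) ^ (i + 1)) : Polynomial ℤ).coeff n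

namespace Fishburn

/-- The base `q = 1 - t`, where `t` is the variable of `(ZMod 5)[X]`. -/
noncomputable def base : (ZMod 5)[X] := 1 - X

/-- Differentiation with respect to `t` on `(ZMod 5)[X][X]`, whose inner variable
is `t` and outer variable is `x`. -/
noncomputable def diffT : Derivation (ZMod 5) (ZMod 5)[X][X] (ZMod 5)[X][X] :=
  (PolynomialModule.equivPolynomialSelf (R := (ZMod 5)[X])).toLinearMap.compDer
    (Polynomial.derivative' (R := ZMod 5)).mapCoeffs

/-- Evaluation at `x = 1`, `t = 0`. -/
noncomputable def evalPoint : (ZMod 5)[X][X] →+* ZMod 5 :=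
  (evalRingHom 0).comp (evalRingHom 1)

/-- The maximal ideal of the point `x = 1`, `t = 0`. -/
noncomputable def pointIdeal : Ideal (ZMod 5)[X][X] := RingHom.ker evalPoint

/-- The substitution `x ↦ r x`. -/
noncomputable def dilate (r : (ZMod 5)[X]) : (ZMod 5)[X][X] →+* (ZMod 5)[X][X] :=
  compRingHom (C r * X)

/-- The operator `f(x) ↦ q² x³ f(q x)`. -/
noncomputable def shift : (ZMod 5)[X][X] →+ (ZMod 5)[X][X] :=
  (AddMonoidHom.mulLeft (C (base ^ 2) * X ^ 3)).comp (dilate base).toAddMonoidHom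

/-- The partial sum `∑_{n ≤ N} (x; q)_{n+1} xⁿ`. -/
noncomputable def partialSum (N : ℕ) : (ZMod 5)[X][X] :=
  ∑ n ∈ range (N + 1), (∏ i ∈ range (n + 1), (1 - C (base ^ i) * X)) * X ^ n

lemma coeff_diffT (p : (ZMod 5)[X][X]) (n : ℕ) : (diffT p).coeff n = derivative (p.coeff n) := by
  induction p using Polynomial.induction_on' with
  | add p q hp hq => simp [hp, hq]
  | monomial m a =>
    simp [diffT, LinearMap.compDer, coeff_monomial, apply_ite derivative]

lemma diffT_C_mul (a : (ZMod 5)[X]) (p : (ZMod 5)[X][X]) (ha : derivative a = 0) :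
    diffT (C a * p) = C a * diffT p := by
  ext1 n
  simp only [coeff_diffT, coeff_C_mul, derivative_mul, ha]
  ring

lemma diffT_C_mul_X_pow (a : (ZMod 5)[X]) (m : ℕ) :
    diffT (C a * X ^ m) = C (derivative a) * X ^ m := by
  ext1 n
  simp only [coeff_diffT, coeff_C_mul, coeff_X_pow]
  split_ifs <;> simp

lemma diffT_mul_X_pow (p : (ZMod 5)[X][X]) (m : ℕ) : diffT (p * X ^ m) = diffT p * X ^ m := by
  ext1 n
  simp only [coeff_diffT, coeff_mul_X_pow']
  split_ifs <;> simp

lemma diffT_dilate (r : (ZMod 5)[X]) (hr : derivative r = 0) (p : (ZMod 5)[X][X]) :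
    diffT (dilate r p) = dilate r (diffT p) := by
  ext1 n
  simp [coeff_diffT, dilate, derivative_pow, hr]

lemma derivative_diffT (p : (ZMod 5)[X][X]) : derivative (diffT p) = diffT (derivative p) := by
  ext1 n
  simp [coeff_diffT, coeff_derivative]

lemma eval_one_diffT (p : (ZMod 5)[X][X]) : (diffT p).eval 1 = derivative (p.eval 1) := by
  induction p using Polynomial.induction_on' with
  | add p q hp hq => simp [hp, hq]
  | monomial n a =>
    rw [← C_mul_X_pow_eq_monomial, diffT_C_mul_X_pow]
    simp only [eval_mul, eval_C, eval_pow, eval_X, one_pow, mul_one]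

lemma derivative_base_pow_five_mul (k : ℕ) : derivative (base ^ (5 * k)) = 0 := by
  have h5 : (5 : ZMod 5) = 0 := by decide
  simp [base, derivative_pow, h5]

/-- A derivation lowers the order of vanishing along an ideal by at most one. -/
lemma derivation_mem_pow {K A : Type*} [CommRing K] [CommRing A] [Algebra K A]
    (d : Derivation K A A) (I : Ideal A) (k : ℕ) {f : A} (hf : f ∈ I ^ (k + 1)) :
    d f ∈ I ^ k := by
  induction k generalizing f with
  | zero => simp
  | succ k ih =>
    rw [pow_succ] at hf
    refine Submodule.mul_induction_on hf (fun g hg h hh => ?_) (fun g h hg hh => ?_)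
    · rw [d.leibniz, smul_eq_mul, smul_eq_mul]
      refine add_mem (Ideal.mul_mem_right _ _ hg) ?_
      rw [mul_comm, pow_succ]
      exact Ideal.mul_mem_mul (ih hg) hh
    · rw [map_add]
      exact add_mem hg hh

/-- If an endomorphism moves elements by elements of `I ^ 2`, then it acts trivially on the
graded pieces `I ^ k / I ^ (k + 1)`. -/
lemma map_sub_self_mem_pow {A : Type*} [CommRing A] (I : Ideal A) (σ : A →+* A)
    (hσ : ∀ g, σ g - g ∈ I ^ 2) (k : ℕ) {f : A} (hf : f ∈ I ^ k) : σ f - f ∈ I ^ (k + 1) := by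
  induction k generalizing f with
  | zero => exact Ideal.pow_le_pow_right (by norm_num) (hσ f)
  | succ k ih =>
    rw [pow_succ] at hf
    refine Submodule.mul_induction_on hf (fun g hg h hh => ?_) (fun g h hg hh => ?_)
    · have hσg : σ g ∈ I ^ k := by
        have := add_mem (Ideal.pow_le_pow_right (Nat.le_succ k) (ih hg)) hg
        simpa using this
      have : σ (g * h) - g * h = σ g * (σ h - h) + (σ g - g) * h := by
        rw [map_mul]; ring
      rw [this]
      refine add_mem ?_ ?_
      · rw [show k + 1 + 1 = k + 2 by ring, pow_add]
        exact Ideal.mul_mem_mul hσg (hσ h)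
      · rw [pow_succ]
        exact Ideal.mul_mem_mul (ih hg) hh
    · have : σ (g + h) - (g + h) = (σ g - g) + (σ h - h) := by rw [map_add]; ring
      rw [this]
      exact add_mem hg hh

lemma map_mem_pow {A B : Type*} [CommRing A] [CommRing B] (φ : A →+* B) (I : Ideal A)
    (J : Ideal B) (h : ∀ g ∈ I, φ g ∈ J) (k : ℕ) {f : A} (hf : f ∈ I ^ k) : φ f ∈ J ^ k :=
  Ideal.le_comap_pow φ k (Ideal.pow_right_mono (fun g hg => h g hg) k hf)

lemma mem_pointIdeal (f : (ZMod 5)[X][X]) : f ∈ pointIdeal ↔ (f.eval 1).eval 0 = 0 := Iff.rfl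

lemma dilate_apply (r : (ZMod 5)[X]) (f : (ZMod 5)[X][X]) : dilate r f = f.comp (C r * X) := rfl

lemma dilate_C (r a : (ZMod 5)[X]) : dilate r (C a) = C a := by simp [dilate_apply]

lemma dilate_X (r : (ZMod 5)[X]) : dilate r X = C r * X := by simp [dilate_apply]

lemma dilate_dilate (r s : (ZMod 5)[X]) (f : (ZMod 5)[X][X]) :
    dilate r (dilate s f) = dilate (r * s) f := by
  ext1 n
  simp only [dilate_apply, comp_C_mul_X_coeff]
  ring

lemma dilate_mem_pow {r : (ZMod 5)[X]} (hr : r.eval 0 = 1) (k : ℕ) {f : (ZMod 5)[X][X]}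
    (hf : f ∈ pointIdeal ^ k) : dilate r f ∈ pointIdeal ^ k := by
  refine map_mem_pow _ _ _ (fun g hg => ?_) k hf
  rw [mem_pointIdeal] at hg ⊢
  rw [dilate_apply, eval_comp]
  simp only [eval_mul, eval_C, eval_X, mul_one]
  have h : (r - 1).eval 0 ∣ (g.eval r - g.eval 1).eval 0 := eval_dvd (sub_dvd_eval_sub r 1 g)
  simp only [eval_sub, hr, eval_one, sub_self, zero_dvd_iff] at h
  rwa [hg, sub_zero] at h

lemma shift_apply (f : (ZMod 5)[X][X]) : shift f = C (base ^ 2) * X ^ 3 * dilate base f := rfl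

lemma shift_mem_pow (k : ℕ) {f : (ZMod 5)[X][X]} (hf : f ∈ pointIdeal ^ k) : shift f ∈ pointIdeal ^ k :=
  Ideal.mul_mem_left _ _ (dilate_mem_pow (by simp [base]) k hf)

lemma shift_C_mul_X_pow (a m : ℕ) :
    shift (C (base ^ a) * X ^ m) = C (base ^ (a + m + 2)) * X ^ (m + 3) := by
  simp only [shift_apply, map_mul, map_pow, dilate_C, dilate_X]
  ring

lemma shift_iterate_five (f : (ZMod 5)[X][X]) :
    shift (shift (shift (shift (shift f)))) =
      C (base ^ (5 * 8)) * (dilate (base ^ (5 * 1)) f * X ^ 15) := by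
  simp only [shift_apply, map_mul, map_pow, dilate_C, dilate_X, dilate_dilate]
  ring_nf

lemma diffT_shift_iterate_five (f : (ZMod 5)[X][X]) :
    diffT (shift (shift (shift (shift (shift f))))) =
      shift (shift (shift (shift (shift (diffT f))))) := by
  rw [shift_iterate_five, shift_iterate_five, diffT_C_mul _ _ (derivative_base_pow_five_mul _),
    diffT_mul_X_pow, diffT_dilate _ (derivative_base_pow_five_mul _)]

lemma dilate_base_pow_five_sub_mem (g : (ZMod 5)[X][X]) :
    dilate (base ^ (5 * 1)) g - g ∈ pointIdeal ^ 2 := by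
  have hX : (C X : (ZMod 5)[X][X]) ∈ pointIdeal := by simp [mem_pointIdeal]
  have hb : base ^ (5 * 1) = 1 - X ^ 5 := by
    have : Fact (Nat.Prime 5) := ⟨by norm_num⟩
    rw [base, mul_one, sub_pow_char, one_pow]
  have hdvd : (C X : (ZMod 5)[X][X]) ^ 5 ∣ dilate (base ^ (5 * 1)) g - g := by
    have h := sub_dvd_eval_sub (C (base ^ (5 * 1)) * X) X (g.map C)
    have e : C (base ^ (5 * 1)) * X - X = (C X : (ZMod 5)[X][X]) ^ 5 * (-X) := by
      rw [hb, map_sub, map_pow, map_one]; ring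
    rw [e, eval_map, eval_map, eval₂_C_X] at h
    exact dvd_of_mul_right_dvd h
  exact Ideal.mem_of_dvd _ hdvd
    (Ideal.pow_le_pow_right (by norm_num) (Ideal.pow_mem_pow hX 5))

lemma shift_iterate_five_sub_self_mem_pow (k : ℕ) {f : (ZMod 5)[X][X]} (hf : f ∈ pointIdeal ^ k) :
    shift (shift (shift (shift (shift f)))) - f ∈ pointIdeal ^ (k + 1) := by
  have hσ := map_sub_self_mem_pow pointIdeal _ dilate_base_pow_five_sub_mem k hf
  have h1 : C (base ^ (5 * 8)) * X ^ 15 - 1 ∈ pointIdeal := by simp [mem_pointIdeal, base]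
  have : shift (shift (shift (shift (shift f)))) - f =
      C (base ^ (5 * 8)) * X ^ 15 * (dilate (base ^ (5 * 1)) f - f) +
        f * (C (base ^ (5 * 8)) * X ^ 15 - 1) := by
    rw [shift_iterate_five]; ring
  rw [this]
  refine add_mem (Ideal.mul_mem_left _ _ hσ) ?_
  rw [pow_succ]
  exact Ideal.mul_mem_mul hf h1

/-- The operator `1 + shift⁵` reflects the order of vanishing at the point. -/
lemma mem_pow_of_add_shift_iterate_five_mem (k : ℕ) {f : (ZMod 5)[X][X]}
    (hf : f + shift (shift (shift (shift (shift f)))) ∈ pointIdeal ^ k) :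
    f ∈ pointIdeal ^ k := by
  suffices ∀ j ≤ k, f ∈ pointIdeal ^ j from this k le_rfl
  intro j hj
  induction j with
  | zero => simp
  | succ j ih =>
    have h1 := shift_iterate_five_sub_self_mem_pow j (ih (by omega))
    have h2 := sub_mem (Ideal.pow_le_pow_right hj hf) h1
    have h5 : (5 : (ZMod 5)[X][X]) = 0 := CharP.cast_eq_zero (ZMod 5)[X][X] 5
    have : f = 3 * (f + shift (shift (shift (shift (shift f)))) -
        (shift (shift (shift (shift (shift f)))) - f)) := by
      linear_combination (-f) * h5
    rw [this]
    exact Ideal.mul_mem_left _ _ h2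

lemma diffT_iterate_three_monomial (a m : ℕ) (ha : (a * (a - 1) * (a - 2) : ZMod 5) = 0) :
    diffT (diffT (diffT (C (base ^ a) * X ^ m))) = 0 := by
  have h : derivative (derivative (derivative (base ^ a))) = 0 := by
    have hd (k : ℕ) : derivative (base ^ (k + 1)) = -(C (k + 1 : ZMod 5) * base ^ k) := by
      simp [base, derivative_pow]
    rcases a with _ | _ | _ | a
    · simp
    · simp [base]
    · simp [base, derivative_pow]
    · have hc := congrArg (C : ZMod 5 → (ZMod 5)[X]) ha
      push_cast at hc
      simp only [map_mul, map_add, map_sub, map_one, map_natCast, map_zero, map_ofNat] at hc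
      simp only [hd, derivative_neg, derivative_C_mul]
      push_cast
      simp only [map_add, map_one, map_natCast, map_ofNat]
      linear_combination (-base ^ a) * hc
  simp only [diffT_C_mul_X_pow, h, map_zero, zero_mul]

/-- The functional equation `S(x) + q² x³ S(q x) = 1 - q x²`, up to an explicit error, for the
partial sums of `S(x) = ∑ (x; q)_{n+1} xⁿ`. -/
lemma partialSum_add_shift (N : ℕ) :
    partialSum N + shift (partialSum N) = 1 - C base * X ^ 2 +
      (∏ i ∈ range (N + 1), (1 - C (base ^ (i + 1)) * X)) *
        ((C (base ^ (N + 2)) * X ^ 2 - 1) * X ^ (N + 1)) := by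
  induction N with
  | zero =>
    simp [partialSum, shift_apply, dilate_X]
    ring
  | succ N ih =>
    have hs : partialSum (N + 1) = partialSum N +
        (1 - X) * (∏ i ∈ range (N + 1), (1 - C (base ^ (i + 1)) * X)) * X ^ (N + 1) := by
      rw [partialSum, sum_range_succ, ← partialSum, prod_range_succ']
      simp only [pow_zero, map_one]
      ring
    have hd : shift ((1 - X) * (∏ i ∈ range (N + 1), (1 - C (base ^ (i + 1)) * X)) * X ^ (N + 1)) =
        C (base ^ 2) * X ^ 3 * ((∏ i ∈ range (N + 2), (1 - C (base ^ (i + 1)) * X)) *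
          (C (base ^ (N + 1)) * X ^ (N + 1))) := by
      rw [shift_apply, prod_range_succ' (fun i => 1 - C (base ^ (i + 1)) * X) (N + 1)]
      simp only [map_mul, map_sub, map_one, map_prod, map_pow, dilate_C, dilate_X]
      simp only [zero_add, pow_one, mul_pow]
      have hprod : ∏ i ∈ range (N + 1), (1 - C base ^ (i + 1) * (C base * X)) =
          ∏ i ∈ range (N + 1), (1 - C base ^ (i + 1 + 1) * X) :=
        prod_congr rfl fun i _ => by ring
      rw [hprod]
      ring
    rw [hs, map_add, hd, add_add_add_comm, ih,
      prod_range_succ (fun i => 1 - C (base ^ (i + 1)) * X) (N + 1)]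
    simp only [map_pow]
    ring

lemma exists_diffT_add_shift_iterate_five_eq (N : ℕ) :
    ∃ e ∈ pointIdeal ^ (N + 2), diffT (diffT (diffT (partialSum N +
      shift (shift (shift (shift (shift (partialSum N)))))))) = diffT (diffT (diffT e)) := by
  set E : (ZMod 5)[X][X] := (∏ i ∈ range (N + 1), (1 - C (base ^ (i + 1)) * X)) *
        ((C (base ^ (N + 2)) * X ^ 2 - 1) * X ^ (N + 1)) with hE
  have hmem : E ∈ pointIdeal ^ (N + 2) := by
    rw [hE, show N + 2 = (N + 1) + 1 by ring, pow_succ]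
    refine Ideal.mul_mem_mul ?_ (Ideal.mul_mem_right _ _ (by simp [mem_pointIdeal, base]))
    have := Ideal.prod_mem_prod (s := range (N + 1)) (I := fun _ => pointIdeal)
      (x := fun i => 1 - C (base ^ (i + 1)) * X) (fun i _ => by simp [mem_pointIdeal, base])
    rwa [prod_const, card_range] at this
  have h0 : partialSum N + shift (partialSum N) =
      C (base ^ 0) * X ^ 0 - C (base ^ 1) * X ^ 2 + E := by
    rw [partialSum_add_shift]; simp [hE]
  have h1 := congrArg shift h0
  have h2 := congrArg shift h1
  have h3 := congrArg shift h2
  have h4 := congrArg shift h3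
  simp only [map_add, map_sub, shift_C_mul_X_pow] at h1 h2 h3 h4
  refine ⟨E - shift E + shift (shift E) - shift (shift (shift E)) +
    shift (shift (shift (shift E))), ?_, ?_⟩
  · have m1 := shift_mem_pow _ hmem
    have m2 := shift_mem_pow _ m1
    have m3 := shift_mem_pow _ m2
    have m4 := shift_mem_pow _ m3
    exact add_mem (sub_mem (add_mem (sub_mem hmem m1) m2) m3) m4
  · have hdiff {f e : (ZMod 5)[X][X]} {a b k m : ℕ}
        (h : f = C (base ^ a) * X ^ k - C (base ^ b) * X ^ m + e)
        (ha : (a * (a - 1) * (a - 2) : ZMod 5) = 0) (hb : (b * (b - 1) * (b - 2) : ZMod 5) = 0) :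
        diffT (diffT (diffT f)) = diffT (diffT (diffT e)) := by
      simp only [h, map_add, map_sub, diffT_iterate_three_monomial _ _ ha,
        diffT_iterate_three_monomial _ _ hb, sub_zero, zero_add]
    have d0 := hdiff h0 (by decide) (by decide)
    have d1 := hdiff h1 (by decide) (by decide)
    have d2 := hdiff h2 (by decide) (by decide)
    have d3 := hdiff h3 (by decide) (by decide)
    have d4 := hdiff h4 (by decide) (by decide)
    simp only [map_add, map_sub] at d0 d1 d2 d3 d4 ⊢
    linear_combination d0 - d1 + d2 - d3 + d4

/-- The truncated Fishburn series modulo `5`. -/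
lemma derivative_partialSum_eval_one (N : ℕ) :
    (derivative (partialSum N)).eval 1 =
      -∑ j ∈ range (N + 1), ∏ i ∈ range j, (1 - base ^ (i + 1)) := by
  have : partialSum N = (1 - X) *
      ∑ n ∈ range (N + 1), (∏ i ∈ range n, (1 - C (base ^ (i + 1)) * X)) * X ^ n := by
    rw [partialSum, mul_sum]
    refine sum_congr rfl fun n _ => ?_
    rw [prod_range_succ']
    simp only [pow_zero, map_one]
    ring
  rw [this, derivative_mul]
  simp [eval_finsetSum, eval_prod]

lemma X_pow_dvd_derivative_iterate_three (N : ℕ) :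
    X ^ N ∣ derivative (derivative (derivative
      (∑ j ∈ range (N + 3), ∏ i ∈ range j, (1 - base ^ (i + 1))))) := by
  obtain ⟨e, he, h⟩ := exists_diffT_add_shift_iterate_five_eq (N + 2)
  have h3 : diffT (diffT (diffT e)) ∈ pointIdeal ^ (N + 1) :=
    derivation_mem_pow _ _ _ (derivation_mem_pow _ _ _ (derivation_mem_pow _ _ _ he))
  rw [← h] at h3
  simp only [map_add, diffT_shift_iterate_five] at h3
  have h4 := derivation_mem_pow derivative' _ _ (mem_pow_of_add_shift_iterate_five_mem _ h3)
  have h5 := map_mem_pow (evalRingHom (1 : (ZMod 5)[X])) pointIdeal (Ideal.span {X})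
    (fun g hg => by
      rw [Ideal.mem_span_singleton, X_dvd_iff, coeff_zero_eq_eval_zero]
      exact hg) _ h4
  rw [Ideal.span_singleton_pow, Ideal.mem_span_singleton] at h5
  have h6 (p : (ZMod 5)[X][X]) : derivative' p = derivative p := rfl
  simpa only [coe_evalRingHom, h6, derivative_diffT, eval_one_diffT,
    derivative_partialSum_eval_one, map_neg, dvd_neg] using h5

end Fishburn

theorem fishburn_mod5_cong3 : ∀ n : ℕ, (5 : ℤ) ∣ fishburn (5 * n + 3) := by
  intro n
  have h := Fishburn.X_pow_dvd_derivative_iterate_three (5 * n + 1)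
  rw [X_pow_dvd_iff] at h
  have h := h (5 * n) (by omega)
  simp only [coeff_derivative] at h
  refine (ZMod.intCast_zmod_eq_zero_iff_dvd _ 5).mp ?_
  have hmap : ((fishburn (5 * n + 3) : ℤ) : ZMod 5) =
      (∑ j ∈ range (5 * n + 1 + 3), ∏ i ∈ range j, (1 - Fishburn.base ^ (i + 1)) :
        (ZMod 5)[X]).coeff (5 * n + 1 + 1 + 1) := by
    rw [fishburn, ← eq_intCast (Int.castRingHom (ZMod 5)), ← coeff_map]
    simp [Polynomial.map_sum, Polynomial.map_prod, Fishburn.base]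
  rw [hmap]
  have h5 : (5 : ZMod 5) = 0 := by decide
  push_cast at h
  simp only [h5, zero_mul] at h
  revert h
  generalize (∑ j ∈ range (5 * n + 1 + 3), ∏ i ∈ range j,
    (1 - Fishburn.base ^ (i + 1)) : (ZMod 5)[X]).coeff (5 * n + 1 + 1 + 1) = c
  revert c
  decide
end

section
/- For all natural numbers n, the Fishburn number ξ(5n+4) is divisible by 5. -/
open Polynomial Finset

/-- The truncated series `∑_{n < K} (x; q)_{n+1} x ^ n` occurring in Zagier's identity. -/
def zagierSum {B : Type*} [CommRing B] (q : B) (K : ℕ) (x : B) : B :=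
  ∑ n ∈ range K, (∏ i ∈ range (n + 1), (1 - x * q ^ i)) * x ^ n

/-- The second pentagonal numbers `m (3 m + 1) / 2`, defined by their recurrence. -/
def secondPentagonal : ℕ → ℕ
  | 0 => 0
  | m + 1 => secondPentagonal m + (3 * m + 2)

theorem two_mul_secondPentagonal (m : ℕ) : 2 * secondPentagonal m = m * (3 * m + 1) := by
  induction m with
  | zero => rfl
  | succ m ih => rw [secondPentagonal, mul_add, ih]; ring

section CommRing

variable {B : Type*} [CommRing B]

theorem zagierSum_succ (q x : B) (K : ℕ) :
    zagierSum q (K + 1) x = 1 - q * x ^ 2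
      - x ^ (K + 1) * ∏ i ∈ range (K + 1), (1 - x * q ^ (i + 1))
      - q ^ 2 * x ^ 3 * zagierSum q K (q * x) := by
  induction K with
  | zero => simp [zagierSum]; ring
  | succ K ih =>
    have hl : zagierSum q (K + 1 + 1) x = zagierSum q (K + 1) x
        + (∏ i ∈ range (K + 1), (1 - x * q ^ (i + 1))) * (1 - x) * x ^ (K + 1) := by
      rw [zagierSum, sum_range_succ, prod_range_succ' _ (K + 1)]
      simp [zagierSum]
    have hr : zagierSum q (K + 1) (q * x) = zagierSum q K (q * x)
        + (∏ i ∈ range (K + 1), (1 - x * q ^ (i + 1))) * (q * x) ^ K := by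
      rw [zagierSum, sum_range_succ]
      congr 2
      refine prod_congr rfl fun i _ => ?_
      ring
    rw [hl, hr, ih, prod_range_succ _ (K + 1)]
    ring

/-- Finite form of Zagier's identity, obtained by iterating the functional equation. -/
theorem zagierSum_add (q : B) (L : ℕ) : ∀ (K : ℕ) (x : B), zagierSum q (K + L) x =
    ∑ m ∈ range L, (-1) ^ m * x ^ (3 * m) * q ^ secondPentagonal m * (1 - q ^ (2 * m + 1) * x ^ 2
      - (q ^ m * x) ^ (K + L - m) * ∏ i ∈ range (K + L - m), (1 - x * q ^ (m + 1 + i)))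
    + (-1) ^ L * x ^ (3 * L) * q ^ secondPentagonal L * zagierSum q K (q ^ L * x) := by
  induction L with
  | zero => intro K x; simp [secondPentagonal]
  | succ L ih =>
    intro K x
    have h := ih (K + 1) x
    rw [show K + 1 + L = K + (L + 1) by ring] at h
    rw [h, sum_range_succ, zagierSum_succ, show K + (L + 1) - L = K + 1 by omega]
    have hp : ∏ i ∈ range (K + 1), (1 - q ^ L * x * q ^ (i + 1))
        = ∏ i ∈ range (K + 1), (1 - x * q ^ (L + 1 + i)) :=
      prod_congr rfl fun i _ => by ring
    rw [hp, secondPentagonal, show q * (q ^ L * x) = q ^ (L + 1) * x by ring]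
    ring

theorem prod_one_sub_eq_zero {q : B} {N n : ℕ} (hN : 0 < N) (hq : q ^ N = 1) (hn : N ≤ n) :
    ∏ i ∈ range n, (1 - q ^ (i + 1)) = 0 :=
  prod_eq_zero (i := N - 1) (mem_range.2 (by omega)) (by rw [Nat.sub_add_cancel hN, hq, sub_self])

theorem sum_prod_one_sub_eq {q : B} {N M : ℕ} (hN : 0 < N) (hq : q ^ N = 1) (hM : N ≤ M) :
    ∑ n ∈ range M, ∏ i ∈ range n, (1 - q ^ (i + 1))
      = ∑ n ∈ range N, ∏ i ∈ range n, (1 - q ^ (i + 1)) := by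
  symm
  refine sum_subset (range_mono hM) fun n _ hn => prod_one_sub_eq_zero hN hq ?_
  simpa using hn

theorem zagierSum_one_sub {e : B} (he : e ^ 2 = 0) (q : B) (K : ℕ) :
    zagierSum q K (1 - e) = e * ∑ n ∈ range K, ∏ i ∈ range n, (1 - q ^ (i + 1)) := by
  have hpow : ∀ n : ℕ, e * (1 - e) ^ n = e := by
    intro n
    induction n with
    | zero => simp
    | succ n ih => rw [pow_succ, ← mul_assoc, ih]; linear_combination -he
  have hprod : ∀ n : ℕ, e * ∏ i ∈ range n, (1 - (1 - e) * q ^ (i + 1))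
      = e * ∏ i ∈ range n, (1 - q ^ (i + 1)) := by
    intro n
    induction n with
    | zero => simp
    | succ n ih =>
      rw [prod_range_succ, prod_range_succ, ← mul_assoc, ih]
      linear_combination (q ^ (n + 1) * ∏ i ∈ range n, (1 - q ^ (i + 1))) * he
  rw [zagierSum, mul_sum]
  refine sum_congr rfl fun n _ => ?_
  rw [prod_range_succ', ← hprod]
  linear_combination (∏ i ∈ range n, (1 - (1 - e) * q ^ (i + 1))) * hpow n

theorem prod_one_sub_mul_pow_eq_zero {q e : B} {N m : ℕ} (hq : q ^ N = 1) (he : e ^ 2 = 0)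
    (hm : m < N) : ∏ i ∈ range (N + N - m), (1 - (1 - e) * q ^ (m + 1 + i)) = 0 := by
  have hsub : ({N - 1 - m, N + N - 1 - m} : Finset ℕ) ⊆ range (N + N - m) := by
    intro i hi
    simp only [mem_insert, mem_singleton] at hi
    rw [mem_range]
    omega
  have hdvd := prod_dvd_prod_of_subset _ _ (fun i => 1 - (1 - e) * q ^ (m + 1 + i)) hsub
  rw [prod_pair (by omega), show m + 1 + (N - 1 - m) = N by omega,
    show m + 1 + (N + N - 1 - m) = N + N by omega, pow_add, hq,
    show (1 - (1 - e) * 1) * (1 - (1 - e) * (1 * 1)) = e ^ 2 by ring, he] at hdvd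
  exact zero_dvd_iff.1 hdvd

theorem pow_secondPentagonal_eq_one {q : B} {N : ℕ} (hodd : Odd N) (hq : q ^ N = 1) :
    q ^ secondPentagonal N = 1 := by
  obtain ⟨k, rfl⟩ := hodd
  have h : secondPentagonal (2 * k + 1) = (2 * k + 1) * (3 * k + 2) := by
    have := two_mul_secondPentagonal (2 * k + 1)
    linarith
  rw [h, pow_mul, hq, one_pow]

theorem two_mul_mul_sum_prod_one_sub {q e : B} {N : ℕ} (hodd : Odd N) (hq : q ^ N = 1)
    (he : e ^ 2 = 0) :
    2 * e * ∑ n ∈ range N, ∏ i ∈ range n, (1 - q ^ (i + 1)) =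
      ∑ m ∈ range N, (-1) ^ m * (1 - e) ^ (3 * m) * q ^ secondPentagonal m
        * (1 - q ^ (2 * m + 1) * (1 - e) ^ 2) := by
  have h := zagierSum_add q N N (1 - e)
  rw [hq, one_mul, pow_secondPentagonal_eq_one hodd hq, hodd.neg_one_pow, zagierSum_one_sub he,
    zagierSum_one_sub he, sum_prod_one_sub_eq hodd.pos hq (Nat.le_add_left N N)] at h
  have hs : ∑ m ∈ range N, (-1) ^ m * (1 - e) ^ (3 * m) * q ^ secondPentagonal m
        * (1 - q ^ (2 * m + 1) * (1 - e) ^ 2 - (q ^ m * (1 - e)) ^ (N + N - m)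
          * ∏ i ∈ range (N + N - m), (1 - (1 - e) * q ^ (m + 1 + i)))
      = ∑ m ∈ range N, (-1) ^ m * (1 - e) ^ (3 * m) * q ^ secondPentagonal m
        * (1 - q ^ (2 * m + 1) * (1 - e) ^ 2) := by
    refine sum_congr rfl fun m hm => ?_
    rw [prod_one_sub_mul_pow_eq_zero hq he (mem_range.1 hm), mul_zero, sub_zero]
  rw [hs] at h
  have hpow : ∀ n : ℕ, (1 - e) ^ n * e = e := by
    intro n
    induction n with
    | zero => simp
    | succ n ih => rw [pow_succ']; linear_combination (1 - e) * ih - he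
  linear_combination h - (∑ n ∈ range N, ∏ i ∈ range n, (1 - q ^ (i + 1))) * hpow (3 * N)

/-- At a root of unity of odd order, twice Fishburn's sum is a combination of powers of `q` with
pentagonal exponents. -/
theorem two_mul_sum_prod_one_sub {q : B} {N : ℕ} (hodd : Odd N) (hq : q ^ N = 1) :
    2 * ∑ n ∈ range N, ∏ i ∈ range n, (1 - q ^ (i + 1)) =
      ∑ m ∈ range N, (-1) ^ m * ((3 * m + 2) * q ^ (secondPentagonal m + (2 * m + 1))
        - 3 * m * q ^ secondPentagonal m) := by
  have he : (DualNumber.eps : DualNumber B) ^ 2 = 0 := by rw [sq, DualNumber.eps_mul_eps]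
  have hpow : ∀ n : ℕ, (1 - DualNumber.eps : DualNumber B) ^ n = 1 - (n : DualNumber B) * DualNumber.eps := by
    intro n
    induction n with
    | zero => simp
    | succ n ih => rw [pow_succ, ih]; push_cast; linear_combination (n : DualNumber B) * he
  let φ := algebraMap B (DualNumber B)
  have h := two_mul_mul_sum_prod_one_sub (q := φ q) hodd (by rw [← map_pow, hq, map_one]) he
  have hl : 2 * DualNumber.eps * ∑ n ∈ range N, ∏ i ∈ range n, (1 - φ q ^ (i + 1))
      = φ (2 * ∑ n ∈ range N, ∏ i ∈ range n, (1 - q ^ (i + 1))) * DualNumber.eps := by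
    simp only [map_mul, map_sum, map_prod, map_sub, map_one, map_pow, map_ofNat]
    ring
  have hr : ∑ m ∈ range N, (-1) ^ m * (1 - DualNumber.eps) ^ (3 * m) * φ q ^ secondPentagonal m
        * (1 - φ q ^ (2 * m + 1) * (1 - DualNumber.eps) ^ 2)
      = φ (∑ m ∈ range N, (-1) ^ m
          * (q ^ secondPentagonal m - q ^ (secondPentagonal m + (2 * m + 1))))
        + φ (∑ m ∈ range N, (-1) ^ m * ((3 * m + 2) * q ^ (secondPentagonal m + (2 * m + 1))
        - 3 * m * q ^ secondPentagonal m)) * DualNumber.eps := by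
    rw [map_sum, map_sum, sum_mul, ← sum_add_distrib]
    refine sum_congr rfl fun m _ => ?_
    simp only [map_mul, map_sub, map_add, map_neg, map_one, map_pow, map_ofNat, map_natCast, hpow]
    push_cast
    linear_combination (-1) ^ m * φ q ^ secondPentagonal m * φ q ^ (2 * m + 1) * (-6 * m) * he
  rw [hl, hr] at h
  have hinl : ∀ b : B, φ b = TrivSqZeroExt.inl b := fun _ => rfl
  simp only [hinl] at h
  simpa using congrArg TrivSqZeroExt.snd h

end CommRing

theorem coeff_one_sub_X_pow_eq_zero {a : ℕ} (ha : a % 5 < 4) (n : ℕ) :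
    ((1 - X : (ZMod 5)[X]) ^ a).coeff (5 * n + 4) = 0 := by
  have : Fact (Nat.Prime 5) := ⟨by norm_num⟩
  have hX : (1 - X : (ZMod 5)[X]) ^ a = ((1 + X : (ZMod 5)[X]) ^ a).comp (C (-1) * X) := by
    simp [sub_eq_add_neg]
  rw [hX, comp_C_mul_X_coeff, coeff_one_add_X_pow]
  have h := Choose.choose_modEq_choose_mod_mul_choose_div_nat (n := a) (k := 5 * n + 4) (p := 5)
  rw [show (5 * n + 4) % 5 = 4 by omega, Nat.choose_eq_zero_of_lt ha, zero_mul] at h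
  rw [(ZMod.natCast_eq_natCast_iff _ _ _).2 h]
  simp

theorem secondPentagonal_mod_five (m : ℕ) :
    secondPentagonal m % 5 < 4 ∧ (secondPentagonal m + (2 * m + 1)) % 5 < 4 := by
  have h := congrArg (· % 5) (two_mul_secondPentagonal m)
  have hm : m % 5 < 5 := Nat.mod_lt _ (by norm_num)
  have hr : m * (3 * m + 1) % 5 = (m % 5) * (3 * (m % 5) + 1) % 5 := by
    simp [Nat.mul_mod, Nat.add_mod]
  simp only [hr] at h
  generalize hk : m % 5 = k at *
  interval_cases k <;> omega

theorem X_pow_dvd_prod_one_sub (R : Type*) [CommRing R] (j : ℕ) :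
    (X : R[X]) ^ j ∣ ∏ i ∈ range j, (1 - (1 - X) ^ (i + 1)) := by
  have h := prod_dvd_prod_of_dvd (s := range j) (f := fun _ => (X : R[X]))
    (g := fun i => 1 - (1 - X) ^ (i + 1)) fun i _ => by
      have hd := sub_dvd_pow_sub_pow (1 : R[X]) (1 - X) (i + 1)
      rwa [sub_sub_cancel, one_pow] at hd
  simpa using h

theorem intCast_fishburn (R : Type*) [CommRing R] {n N : ℕ} (hN : n < N) :
    (fishburn n : R)
      = (∑ j ∈ range N, ∏ i ∈ range j, (1 - (1 - X) ^ (i + 1)) : R[X]).coeff n := by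
  have h : (fishburn n : R)
      = (∑ j ∈ range (n + 1), ∏ i ∈ range j, (1 - (1 - X) ^ (i + 1)) : R[X]).coeff n := by
    rw [fishburn, ← eq_intCast (Int.castRingHom R), ← coeff_map]
    simp [Polynomial.map_sum, Polynomial.map_prod]
  rw [h, finsetSum_coeff, finsetSum_coeff]
  refine sum_subset (range_mono hN) fun j _ hj => ?_
  refine X_pow_dvd_iff.1 (X_pow_dvd_prod_one_sub R j) n ?_
  simpa using hj

theorem fishburn_mod5_cong4 : ∀ n : ℕ, (5 : ℤ) ∣ fishburn (5 * n + 4) := by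
  intro n
  have h2 : (2 : ZMod 5) ≠ 0 := by decide
  have : Fact (Nat.Prime 5) := ⟨by norm_num⟩
  let N := 5 ^ (5 * n + 4)
  have hN : 5 * n + 4 < N := Nat.lt_pow_self (by norm_num)
  have hodd : Odd N := Odd.pow (by decide)
  let π := Ideal.Quotient.mk (Ideal.span {(X : (ZMod 5)[X]) ^ N})
  have hq : π (1 - X) ^ N = 1 := by
    rw [← map_pow, sub_pow_char_pow, one_pow, map_sub, map_one, sub_eq_self]
    exact Ideal.Quotient.eq_zero_iff_mem.2 (Ideal.mem_span_singleton_self _)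
  have h := two_mul_sum_prod_one_sub hodd hq
  let f : ℕ → (ZMod 5)[X] := fun m =>
    (-1) ^ m * ((3 * m + 2) * (1 - X : (ZMod 5)[X]) ^ (secondPentagonal m + (2 * m + 1))
      - 3 * m * (1 - X : (ZMod 5)[X]) ^ secondPentagonal m)
  have hdvd : (X : (ZMod 5)[X]) ^ N ∣
      2 * ∑ j ∈ range N, ∏ i ∈ range j, (1 - (1 - X) ^ (i + 1)) - ∑ m ∈ range N, f m := by
    rw [← Ideal.mem_span_singleton, ← Ideal.Quotient.eq]
    simpa only [f, π, map_mul, map_sum, map_prod, map_sub, map_add, map_neg, map_one, map_pow,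
      map_ofNat, map_natCast] using h
  have hc := X_pow_dvd_iff.1 hdvd _ hN
  have hzero : (∑ m ∈ range N, f m).coeff (5 * n + 4) = 0 := by
    rw [finsetSum_coeff]
    refine sum_eq_zero fun m _ => ?_
    have hC : f m
        = C ((-1) ^ m * (3 * m + 2) : ZMod 5) * (1 - X) ^ (secondPentagonal m + (2 * m + 1))
        - C ((-1) ^ m * (3 * m) : ZMod 5) * (1 - X) ^ secondPentagonal m := by
      simp only [f, map_mul, map_add, map_neg, map_one, map_pow, map_ofNat, map_natCast]
      ring
    rw [hC, coeff_sub, coeff_C_mul, coeff_C_mul,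
      coeff_one_sub_X_pow_eq_zero (secondPentagonal_mod_five m).1,
      coeff_one_sub_X_pow_eq_zero (secondPentagonal_mod_five m).2]
    simp
  rw [coeff_sub, hzero, sub_zero, ← map_ofNat C 2, coeff_C_mul,
    ← intCast_fishburn (ZMod 5) hN] at hc
  exact (ZMod.intCast_zmod_eq_zero_iff_dvd _ 5).1 ((mul_eq_zero.1 hc).resolve_left h2)
end
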